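/- Let h ∈ C[x_0,x_1,x_2,x_3] be homogeneous of degree 4, not a square, set f_4 = x_4^2 − h and A = C[x_0,...,x_4]/(f_4) with weights (1,1,1,1,2), and let g_3 ∈ C[x_0,...,x_4] be nonzero and homogeneous of weighted degree 3. Consider the family of fourfolds X_t ⊂ P(1,1,1,1,2,1) defined by f_4 + t·g_3·x_5 = 0, with weights (1,1,1,1,2,1) and x_5 of weight 1, so that X_0 is the cone over the quartic double solid Y = {f_4 = 0} ⊂ P(1,1,1,1,2). Then: (i) for every t ≠ 0 the function field K_0(C[x_0,...,x_5]/(f_4 + t g_3 x_5)) is C-isomorphic to the rational function field C(y_1,y_2,y_3,y_4), so X_t is rational; and (ii) the function field K_0(A[x_5]) of X_0 is isomorphic to the rational function field K_0(A)(u) in one variable over the function field of Y, and consequently if K_0(A) is stably irrational then so is K_0(A[x_5]), i.e. X_0 is stably irrational whenever Y is. (This is the function-field content of the paper's main theorem: rationality does not specialize in this family.) -/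

import Mathlib

/-!
Formalization of statements from "Rationality does not specialize among terminal fourfolds"
(A. Perry). We work over `ℂ`. The weighted projective space `P(1,1,1,1,2)` has homogeneous
coordinate ring `ℂ[x₀,…,x₄] = MvPolynomial (Fin 5) ℂ` with weights `w5 = (1,1,1,1,2)`, and
`P(1,1,1,1,2,1)` has coordinate ring `MvPolynomial (Fin 6) ℂ` with weights `w6 = (1,1,1,1,2,1)`.
-/

noncomputable section
open MvPolynomial

/-- The weights `(1,1,1,1,2)` of the weighted projective space `P(1,1,1,1,2)`. -/
def w5 : Fin 5 → ℕ := ![1, 1, 1, 1, 2]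

/-- The weights `(1,1,1,1,2,1)` of the weighted projective space `P(1,1,1,1,2,1)`. -/
def w6 : Fin 6 → ℕ := ![1, 1, 1, 1, 2, 1]

/-- The polynomial `f₄ = x₄² − h(x₀,x₁,x₂,x₃) ∈ ℂ[x₀,…,x₄]` cutting out the quartic
double solid `Y ⊂ P(1,1,1,1,2)`. -/
def f4 (h : MvPolynomial (Fin 4) ℂ) : MvPolynomial (Fin 5) ℂ :=
  X 4 ^ 2 - rename Fin.castSucc h

/-- The degree-zero homogeneous fraction field `K₀(A)` of an `ℕ`-graded `ℂ`-algebra `A`,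
as a subalgebra of `FractionRing A`: it consists of `0` together with all fractions `a/b`
where `a, b` are homogeneous elements of `A` of the same degree with `b` nonzero
(a nonzerodivisor).  Here `Hom a d` is the predicate "`a` is homogeneous of degree `d`";
the hypotheses `h1`, `hmul`, `hadd` record that constants are homogeneous of degree `0`,
that products of homogeneous elements are homogeneous of the sum of the degrees, and that
sums of homogeneous elements of the same degree are homogeneous. -/
def K0 {A : Type*} [CommRing A] [Algebra ℂ A] (Hom : A → ℕ → Prop)
    (h1 : ∀ c : ℂ, Hom (algebraMap ℂ A c) 0)
    (hmul : ∀ {a b : A} {d e : ℕ}, Hom a d → Hom b e → Hom (a * b) (d + e))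
    (hadd : ∀ {a b : A} {d : ℕ}, Hom a d → Hom b d → Hom (a + b) d) :
    Subalgebra ℂ (FractionRing A) where
  carrier := {z | z = 0 ∨ ∃ a b : A, ∃ d : ℕ, Hom a d ∧ Hom b d ∧ b ∈ nonZeroDivisors A ∧
      z * algebraMap A (FractionRing A) b = algebraMap A (FractionRing A) a}
  mul_mem' := by
    rintro z₁ z₂ (rfl | ⟨a₁, b₁, d₁, ha₁, hb₁, hb₁0, e₁⟩) h₂
    · left; rw [zero_mul]
    rcases h₂ with rfl | ⟨a₂, b₂, d₂, ha₂, hb₂, hb₂0, e₂⟩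
    · left; rw [mul_zero]
    right
    exact ⟨a₁ * a₂, b₁ * b₂, d₁ + d₂, hmul ha₁ ha₂, hmul hb₁ hb₂, mul_mem hb₁0 hb₂0, by
      rw [map_mul, map_mul]
      linear_combination (z₂ * algebraMap A (FractionRing A) b₂) * e₁
        + algebraMap A (FractionRing A) a₁ * e₂⟩
  one_mem' := by
    right
    refine ⟨1, 1, 0, ?_, ?_, one_mem _, by simp⟩ <;> simpa using h1 1
  add_mem' := by
    rintro z₁ z₂ (rfl | ⟨a₁, b₁, d₁, ha₁, hb₁, hb₁0, e₁⟩) h₂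
    · rw [zero_add]; exact h₂
    rcases h₂ with rfl | ⟨a₂, b₂, d₂, ha₂, hb₂, hb₂0, e₂⟩
    · rw [add_zero]; right; exact ⟨a₁, b₁, d₁, ha₁, hb₁, hb₁0, e₁⟩
    right
    refine ⟨a₁ * b₂ + b₁ * a₂, b₁ * b₂, d₁ + d₂, hadd (hmul ha₁ hb₂) (hmul hb₁ ha₂),
      hmul hb₁ hb₂, mul_mem hb₁0 hb₂0, ?_⟩
    rw [map_mul, map_add, map_mul, map_mul]
    linear_combination algebraMap A (FractionRing A) b₂ * e₁
      + algebraMap A (FractionRing A) b₁ * e₂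
  zero_mem' := Or.inl rfl
  algebraMap_mem' := fun c => by
    right
    exact ⟨algebraMap ℂ A c, 1, 0, h1 c, by simpa using h1 1, one_mem _, by
      simp [IsScalarTower.algebraMap_apply ℂ A (FractionRing A)]⟩

/-- Homogeneity of degree `d` in the quotient of `ℂ[x₀,…,x_{n-1}]` (weighted by `w`)
by the ideal generated by `f`: an element is homogeneous of degree `d` iff it is the image
of a weighted-homogeneous polynomial of weighted degree `d`. -/
def HomQuot {n : ℕ} (w : Fin n → ℕ) (f : MvPolynomial (Fin n) ℂ)
    (a : MvPolynomial (Fin n) ℂ ⧸ Ideal.span {f}) (d : ℕ) : Prop :=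
  ∃ p : MvPolynomial (Fin n) ℂ, p.IsWeightedHomogeneous w d ∧ Ideal.Quotient.mk _ p = a

theorem HomQuot.h1 {n : ℕ} (w : Fin n → ℕ) (f : MvPolynomial (Fin n) ℂ) (c : ℂ) :
    HomQuot w f (algebraMap ℂ _ c) 0 :=
  ⟨C c, isWeightedHomogeneous_C w c, rfl⟩

theorem HomQuot.mul {n : ℕ} {w : Fin n → ℕ} {f : MvPolynomial (Fin n) ℂ}
    {a b : MvPolynomial (Fin n) ℂ ⧸ Ideal.span {f}} {d e : ℕ}
    (ha : HomQuot w f a d) (hb : HomQuot w f b e) : HomQuot w f (a * b) (d + e) := by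
  obtain ⟨p, hp, rfl⟩ := ha
  obtain ⟨q, hq, rfl⟩ := hb
  exact ⟨p * q, hp.mul hq, map_mul _ _ _⟩

theorem HomQuot.add {n : ℕ} {w : Fin n → ℕ} {f : MvPolynomial (Fin n) ℂ}
    {a b : MvPolynomial (Fin n) ℂ ⧸ Ideal.span {f}} {d : ℕ}
    (ha : HomQuot w f a d) (hb : HomQuot w f b d) : HomQuot w f (a + b) d := by
  obtain ⟨p, hp, rfl⟩ := ha
  obtain ⟨q, hq, rfl⟩ := hb
  refine ⟨p + q, ?_, map_add _ _ _⟩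
  rw [← mem_weightedHomogeneousSubmodule] at hp hq ⊢
  exact Submodule.add_mem _ hp hq

/-- The degree-zero homogeneous fraction field of `ℂ[x₀,…,x_{n-1}]/(f)` with respect to the
weights `w`; when `f` is irreducible and weighted-homogeneous this is the function field of
the hypersurface `{f = 0}` in the weighted projective space `P(w)`. -/
abbrev K0Quot {n : ℕ} (w : Fin n → ℕ) (f : MvPolynomial (Fin n) ℂ) :
    Subalgebra ℂ (FractionRing (MvPolynomial (Fin n) ℂ ⧸ Ideal.span {f})) :=
  K0 (HomQuot w f) (HomQuot.h1 w f) (fun ha hb => ha.mul hb) (fun ha hb => ha.add hb)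

instance K0.instCommRingSubtype {A : Type*} [CommRing A] [Algebra ℂ A]
    (Hom : A → ℕ → Prop) (h1 : ∀ c : ℂ, Hom (algebraMap ℂ A c) 0)
    (hmul : ∀ {a b : A} {d e : ℕ}, Hom a d → Hom b e → Hom (a * b) (d + e))
    (hadd : ∀ {a b : A} {d : ℕ}, Hom a d → Hom b d → Hom (a + b) d) :
    CommRing ↥(K0 Hom h1 hmul hadd) :=
  inferInstance

instance K0.instAlgebraSubtype {A : Type*} [CommRing A] [Algebra ℂ A]
    (Hom : A → ℕ → Prop) (h1 : ∀ c : ℂ, Hom (algebraMap ℂ A c) 0)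
    (hmul : ∀ {a b : A} {d e : ℕ}, Hom a d → Hom b e → Hom (a * b) (d + e))
    (hadd : ∀ {a b : A} {d : ℕ}, Hom a d → Hom b d → Hom (a + b) d) :
    Algebra ℂ ↥(K0 Hom h1 hmul hadd) :=
  inferInstance

set_option synthInstance.maxHeartbeats 400000
set_option maxHeartbeats 1000000

/-- The polynomial `f₄ + t·g₃·x₅ ∈ ℂ[x₀,…,x₅]` cutting out the fiber
`X_t ⊂ P(1,1,1,1,2,1)` of the family of fourfolds; for `t = 0` it is `f₄` itself, cutting
out the cone `X₀` over the quartic double solid `Y = {f₄ = 0} ⊂ P(1,1,1,1,2)`. -/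
def famPoly (h : MvPolynomial (Fin 4) ℂ) (g3 : MvPolynomial (Fin 5) ℂ) (t : ℂ) :
    MvPolynomial (Fin 6) ℂ :=
  rename Fin.castSucc (f4 h) + C t * rename Fin.castSucc g3 * X 5

/-- The polynomial `f₄ = x₄² − h` viewed in `ℂ[x₀,…,x₅]`; the quotient
`ℂ[x₀,…,x₅]/(f₄) = A[x₅]` is the homogeneous coordinate ring of the central fiber `X₀`. -/
def f4cone (h : MvPolynomial (Fin 4) ℂ) : MvPolynomial (Fin 6) ℂ :=
  rename Fin.castSucc (f4 h)

/-- A `ℂ`-algebra `F` (in practice, a field containing `ℂ`) is *stably irrational* if for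
all `n, m ≥ 0` the rational function field `F(t₁,…,t_n)` is not `ℂ`-algebra isomorphic to
the rational function field `ℂ(s₁,…,s_m)`.  The rational function fields are realized as
fraction fields of polynomial rings. -/
def StablyIrrational (F : Type*) [CommRing F] [Algebra ℂ F] : Prop :=
  ∀ n m : ℕ,
    IsEmpty ((FractionRing (MvPolynomial (Fin n) F)) ≃ₐ[ℂ]
      FractionRing (MvPolynomial (Fin m) ℂ))

open Polynomial in
theorem aeval_wh {n : ℕ} {w : Fin n → ℕ} {d : ℕ} {P : MvPolynomial (Fin n) ℂ}
    (hP : P.IsWeightedHomogeneous w d) {B : Type*} [CommRing B] [Algebra ℂ B] (c : B)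
    (y z : Fin n → B) (hz : ∀ i, z i = c ^ w i * y i) :
    MvPolynomial.aeval z P = c ^ d * MvPolynomial.aeval y P := by
  rw [MvPolynomial.aeval_def, MvPolynomial.aeval_def, MvPolynomial.eval₂_eq,
    MvPolynomial.eval₂_eq, Finset.mul_sum]
  refine Finset.sum_congr rfl fun m hm => ?_
  have h1 := hP (MvPolynomial.mem_support_iff.1 hm)
  have h2 : ∏ i ∈ m.support, z i ^ m i = c ^ d * ∏ i ∈ m.support, y i ^ m i := by
    rw [← h1, Finsupp.weight_apply, Finsupp.sum, ← Finset.prod_pow_eq_pow_sum,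
      ← Finset.prod_mul_distrib]
    refine Finset.prod_congr rfl fun i _ => ?_
    rw [hz, mul_pow, ← pow_mul, smul_eq_mul, mul_comm (w i)]
  rw [h2]; ring

/-- The substitution `x_i ↦ y_i s^{w_i}`. -/
def homSub {n : ℕ} (w : Fin n → ℕ) {B : Type*} [CommRing B] [Algebra ℂ B] (y : Fin n → B) :
    MvPolynomial (Fin n) ℂ →ₐ[ℂ] Polynomial B :=
  MvPolynomial.aeval (fun i => Polynomial.X ^ w i * Polynomial.C (y i))

theorem homSub_hom {n : ℕ} {w : Fin n → ℕ} {B : Type*} [CommRing B] [Algebra ℂ B]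
    (y : Fin n → B) {d : ℕ} {P : MvPolynomial (Fin n) ℂ} (hP : P.IsWeightedHomogeneous w d) :
    homSub w y P = Polynomial.X ^ d * Polynomial.C (MvPolynomial.aeval y P) := by
  rw [homSub, aeval_wh hP Polynomial.X (fun i => Polynomial.C (y i)) _ (fun i => rfl)]
  congr 1
  exact (MvPolynomial.comp_aeval_apply (R := ℂ) y (Polynomial.CAlgHom (R := ℂ) (A := B)) P).symm

theorem homSub_coeff {n : ℕ} (w : Fin n → ℕ) {B : Type*} [CommRing B] [Algebra ℂ B]
    (y : Fin n → B) (P : MvPolynomial (Fin n) ℂ) (d : ℕ) :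
    (homSub w y P).coeff d = MvPolynomial.aeval y (weightedHomogeneousComponent w d P) := by
  conv_lhs => rw [← sum_weightedHomogeneousComponent w P]
  rw [finsum_eq_sum_of_support_subset (s := (weightedHomogeneousComponent_finsupp (w := w) P).toFinset)
    _ (fun x hx => (Set.Finite.mem_toFinset _).2 hx)]
  rw [map_sum, Polynomial.finsetSum_coeff]
  simp_rw [homSub_hom y (weightedHomogeneousComponent_isWeightedHomogeneous (w := w) _ P)]
  simp only [Polynomial.coeff_X_pow_mul', Polynomial.coeff_C]
  rw [Finset.sum_eq_single d]
  · simp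
  · intro b _ hb
    split_ifs <;> first | rfl | omega
  · intro hd
    have : weightedHomogeneousComponent w d P = 0 := by
      by_contra hne
      exact hd ((Set.Finite.mem_toFinset _).2 hne)
    simp [this]

theorem dvd_of_comps {n : ℕ} (w : Fin n → ℕ) (f P : MvPolynomial (Fin n) ℂ)
    (hf : ∀ d, f ∣ weightedHomogeneousComponent w d P) : f ∣ P := by
  rw [← sum_weightedHomogeneousComponent w P]
  rw [finsum_eq_sum_of_support_subset (s := (weightedHomogeneousComponent_finsupp (w := w) P).toFinset)
    _ (fun x hx => (Set.Finite.mem_toFinset _).2 hx)]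
  exact Finset.dvd_sum fun d _ => hf d

theorem not_dvd_of_lt {n : ℕ} {w : Fin n → ℕ} {f P : MvPolynomial (Fin n) ℂ} {e d : ℕ}
    (hf : f.IsWeightedHomogeneous w e) (hP : P.IsWeightedHomogeneous w d) (hde : d < e)
    (h0 : P ≠ 0) : ¬ f ∣ P := by
  rintro ⟨q, hq⟩
  have h1 := congrArg (fun p => (homSub w (X : Fin n → MvPolynomial (Fin n) ℂ) p).coeff d) hq
  simp only [map_mul] at h1
  rw [homSub_hom _ hP, homSub_hom _ hf, mul_assoc, Polynomial.coeff_X_pow_mul',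
    Polynomial.coeff_X_pow_mul', if_pos le_rfl, if_neg (by omega)] at h1
  simp at h1
  exact h0 h1

/-- Last variable as polynomial variable. -/
def lastEquiv (n : ℕ) : MvPolynomial (Fin (n + 1)) ℂ ≃ₐ[ℂ] Polynomial (MvPolynomial (Fin n) ℂ) :=
  (renameEquiv ℂ (_root_.finSuccEquivLast (n := n))).trans (optionEquivLeft ℂ (Fin n))

theorem lastEquiv_castSucc (n : ℕ) (i : Fin n) :
    lastEquiv n (X i.castSucc) = Polynomial.C (X i) := by
  simp [lastEquiv]

theorem lastEquiv_last (n : ℕ) : lastEquiv n (X (Fin.last n)) = Polynomial.X := by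
  simp [lastEquiv]

theorem lastEquiv_rename (n : ℕ) (p : MvPolynomial (Fin n) ℂ) :
    lastEquiv n (rename Fin.castSucc p) = Polynomial.C p := by
  induction p using MvPolynomial.induction_on with
  | C a => simp [lastEquiv]
  | add p q hp hq => simp [hp, hq]
  | mul_X p i hp => simp [hp, lastEquiv_castSucc]

theorem aeval_lastEquiv {n : ℕ} {B : Type*} [CommRing B] [Algebra ℂ B] (y : Fin n → B) (u : B)
    (z : Fin (n+1) → B) (hz : ∀ i : Fin n, z i.castSucc = y i) (hu : z (Fin.last n) = u)
    (P : MvPolynomial (Fin (n+1)) ℂ) :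
    MvPolynomial.aeval z P =
      Polynomial.eval₂ (MvPolynomial.aeval (R := ℂ) y).toRingHom u (lastEquiv n P) := by
  induction P using MvPolynomial.induction_on with
  | C a => simp [lastEquiv]
  | add p q hp hq => simp only [map_add, hp, hq, Polynomial.eval₂_add]
  | mul_X p i hp =>
    simp only [map_mul, hp, Polynomial.eval₂_mul, aeval_X]
    congr 1
    induction i using Fin.lastCases with
    | last => rw [lastEquiv_last, hu]; simp
    | cast i => rw [lastEquiv_castSucc, hz]; simp

theorem wh_rename {n : ℕ} {w : Fin n → ℕ} {w' : Fin (n+1) → ℕ} (hw : ∀ i : Fin n, w' i.castSucc = w i)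
    {d : ℕ} {P : MvPolynomial (Fin n) ℂ} (hP : P.IsWeightedHomogeneous w d) :
    (rename Fin.castSucc P).IsWeightedHomogeneous w' d := by
  intro m hm
  obtain ⟨u, rfl, hu⟩ := coeff_rename_ne_zero _ _ _ hm
  rw [← hP hu, Finsupp.weight_apply, Finsupp.weight_apply,
    Finsupp.sum_mapDomain_index (by simp) (by intros; simp [add_mul])]
  simp [hw]

theorem f4_irred (h : MvPolynomial (Fin 4) ℂ)
    (hsq : ¬ ∃ q : MvPolynomial (Fin 4) ℂ, h = q ^ 2) : Irreducible (f4 h) := by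
  rw [← MulEquiv.irreducible_iff (lastEquiv 4)]
  have : lastEquiv 4 (f4 h) = Polynomial.X ^ 2 - Polynomial.C h := by
    rw [f4, map_sub, map_pow, lastEquiv_rename]
    rw [← lastEquiv_last 4]; rfl
  rw [this]
  have hd : (Polynomial.X ^ 2 - Polynomial.C h).natDegree = 2 := Polynomial.natDegree_X_pow_sub_C
  rw [(Polynomial.monic_X_pow_sub_C h (by norm_num)).irreducible_iff_roots_eq_zero_of_degree_le_three
    (by omega) (by omega)]
  rw [Multiset.eq_zero_iff_forall_notMem]
  intro a ha
  have := (Polynomial.mem_roots'.1 ha).2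
  simp [sub_eq_zero] at this
  exact hsq ⟨a, this.symm⟩

theorem f4_hom (h : MvPolynomial (Fin 4) ℂ) (hh : h.IsHomogeneous 4) :
    (f4 h).IsWeightedHomogeneous w5 4 := by
  refine IsWeightedHomogeneous.sub ?_ (wh_rename (w := 1) ?_ hh)
  · exact (isWeightedHomogeneous_X ℂ w5 4).pow 2
  · intro i; fin_cases i <;> rfl

theorem w6_castSucc (i : Fin 5) : w6 i.castSucc = w5 i := by fin_cases i <;> rfl

theorem f4cone_hom (h : MvPolynomial (Fin 4) ℂ) (hh : h.IsHomogeneous 4) :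
    (f4cone h).IsWeightedHomogeneous w6 4 := wh_rename w6_castSucc (f4_hom h hh)

theorem fam_hom (h : MvPolynomial (Fin 4) ℂ) (hh : h.IsHomogeneous 4)
    (g3 : MvPolynomial (Fin 5) ℂ) 
    (hg3hom : g3.IsWeightedHomogeneous w5 3) (t : ℂ) :
    (famPoly h g3 t).IsWeightedHomogeneous w6 4 := by
  refine (f4cone_hom h hh).add ?_
  exact ((wh_rename w6_castSucc hg3hom).C_mul t).mul (isWeightedHomogeneous_X ℂ w6 5)

theorem fam_last (h : MvPolynomial (Fin 4) ℂ) (g3 : MvPolynomial (Fin 5) ℂ) (t : ℂ) :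
    lastEquiv 5 (famPoly h g3 t) = Polynomial.C (C t * g3) * Polynomial.X + Polynomial.C (f4 h) := by
  have h1 : lastEquiv 5 (X 5) = Polynomial.X := lastEquiv_last 5
  have h2 : C t * rename Fin.castSucc g3 = rename Fin.castSucc (C t * g3) := by simp
  rw [famPoly, map_add, lastEquiv_rename, map_mul, h1, h2, lastEquiv_rename, add_comm]

theorem fam_irred (h : MvPolynomial (Fin 4) ℂ) (hh : h.IsHomogeneous 4)
    (hsq : ¬ ∃ q : MvPolynomial (Fin 4) ℂ, h = q ^ 2)
    (g3 : MvPolynomial (Fin 5) ℂ) (hg3 : g3 ≠ 0)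
    (hg3hom : g3.IsWeightedHomogeneous w5 3) (t : ℂ) (ht : t ≠ 0) :
    Irreducible (Polynomial.C (C t * g3) * Polynomial.X + Polynomial.C (f4 h)) := by
  have h0 : C t * g3 ≠ 0 := mul_ne_zero (by simpa using ht) hg3
  apply Polynomial.irreducible_C_mul_X_add_C h0
  refine IsRelPrime.symm (((f4_irred h hsq).isRelPrime_iff_not_dvd).2 ?_)
  exact not_dvd_of_lt (f4_hom h hh) (hg3hom.C_mul t) (by norm_num) h0

theorem dvd_of_root {R M : Type*} [CommRing R] [IsDomain R] [UniqueFactorizationMonoid R]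
    [Field M] [Algebra R M] [IsFractionRing R M] (a b : R) (ha : a ≠ 0)
    (hI : Irreducible (Polynomial.C a * Polynomial.X + Polynomial.C b)) (r : M)
    (hr : r * algebraMap R M a = - algebraMap R M b) (p : Polynomial R)
    (hp : Polynomial.eval₂ (algebraMap R M) r p = 0) :
    Polynomial.C a * Polynomial.X + Polynomial.C b ∣ p := by
  classical
  let _ : NormalizedGCDMonoid R := Classical.choice inferInstance
  have hprim := hI.isPrimitive (by
    rw [Polynomial.natDegree_linear ha]; norm_num)
  apply hprim.dvd_of_fraction_map_dvd_fraction_map (K := M)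
  have ha' : algebraMap R M a ≠ 0 := by simpa using ha
  have h1 : (Polynomial.C a * Polynomial.X + Polynomial.C b).map (algebraMap R M)
      = Polynomial.C (algebraMap R M a) * (Polynomial.X - Polynomial.C r) := by
    have : Polynomial.C (algebraMap R M b) = - (Polynomial.C r * Polynomial.C (algebraMap R M a)) := by
      rw [← Polynomial.C_mul, hr]; simp
    simp [this]; ring
  rw [h1]
  have hu : IsUnit (Polynomial.C (algebraMap R M a)) := Polynomial.isUnit_C.2 (Ne.isUnit ha')
  rw [hu.mul_left_dvd, Polynomial.dvd_iff_isRoot, Polynomial.IsRoot, Polynomial.eval_map]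
  exact hp

theorem K0_iso {A : Type*} [CommRing A] [Algebra ℂ A] (Hom : A → ℕ → Prop)
    (h1 : ∀ c : ℂ, Hom (algebraMap ℂ A c) 0)
    (hmul : ∀ {a b : A} {d e : ℕ}, Hom a d → Hom b e → Hom (a * b) (d + e))
    (hadd : ∀ {a b : A} {d : ℕ}, Hom a d → Hom b d → Hom (a + b) d)
    {L : Type*} [Field L] [Algebra ℂ L] (ψ : A →ₐ[ℂ] Polynomial L)
    (hinj : Function.Injective ψ)
    (hψ : ∀ a d, Hom a d → ∃ c : L, ψ a = Polynomial.X ^ d * Polynomial.C c)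
    (hgen : ∀ S : IntermediateField ℂ L, (∀ a b d c e, Hom a d → Hom b d →
      ψ a = Polynomial.X ^ d * Polynomial.C c → ψ b = Polynomial.X ^ d * Polynomial.C e →
      e ≠ 0 → c / e ∈ S) → S = ⊤) :
    Nonempty (↥(K0 Hom h1 hmul hadd) ≃ₐ[ℂ] L) := by
  have hdom : IsDomain A := hinj.isDomain ψ.toRingHom
  let M := FractionRing (Polynomial L)
  let j : Polynomial L →ₐ[ℂ] M := IsScalarTower.toAlgHom ℂ (Polynomial L) M
  have hj : Function.Injective j := IsFractionRing.injective (Polynomial L) M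
  have hg : Function.Injective (j.comp ψ) := hj.comp hinj
  let φ : FractionRing A →ₐ[ℂ] M := IsFractionRing.liftAlgHom (g := j.comp ψ) hg
  have hφ : ∀ a : A, φ (algebraMap A (FractionRing A) a) = j (ψ a) := fun a =>
    IsFractionRing.lift_algebraMap hg a
  let ι : L →ₐ[ℂ] M := j.comp (Polynomial.CAlgHom (R := ℂ) (A := L))
  have hι : ∀ c, ι c = j (Polynomial.C c) := fun c => rfl
  have hX : j Polynomial.X ≠ 0 := by
    rw [Ne, map_eq_zero_iff _ hj]; exact Polynomial.X_ne_zero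
  -- fractions
  have key : ∀ (z : FractionRing A) (a b : A) (d : ℕ) (c e : L), b ≠ 0 →
      z * algebraMap A (FractionRing A) b = algebraMap A (FractionRing A) a →
      ψ a = Polynomial.X ^ d * Polynomial.C c → ψ b = Polynomial.X ^ d * Polynomial.C e →
      e ≠ 0 ∧ φ z = ι (c / e) := by
    intro z a b d c e hb hz ha hb'
    have he : e ≠ 0 := by
      rintro rfl
      apply hb
      apply hinj
      rw [hb', map_zero, map_zero, mul_zero]
    refine ⟨he, ?_⟩
    have h2 := congrArg φ hz
    rw [map_mul, hφ, hφ, ha, hb', map_mul, map_mul, map_pow, ← hι, ← hι] at h2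
    have he' : ι e ≠ 0 := by simpa using he
    rw [map_div₀, eq_div_iff he']
    have h3 : j Polynomial.X ^ d ≠ 0 := pow_ne_zero _ hX
    apply mul_left_cancel₀ h3
    rw [← h2]; ring
  have hsub : ∀ z : ↥(K0 Hom h1 hmul hadd), ∃ c : L, ι c = φ z := by
    rintro ⟨z, hz⟩
    rcases hz with rfl | ⟨a, b, d, ha, hb, hb0, hz⟩
    · exact ⟨0, by simp⟩
    · obtain ⟨c, hc⟩ := hψ a d ha
      obtain ⟨e, he⟩ := hψ b d hb
      exact ⟨c / e, ((key z a b d c e (nonZeroDivisors.ne_zero hb0) hz hc he).2).symm⟩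
  have hinv : ∀ z : FractionRing A, z ∈ K0 Hom h1 hmul hadd → z⁻¹ ∈ K0 Hom h1 hmul hadd := by
    rintro z (rfl | ⟨a, b, d, ha, hb, hb0, hz⟩)
    · rw [inv_zero]; exact zero_mem _
    · by_cases hz0 : z = 0
      · rw [hz0, inv_zero]; exact zero_mem _
      refine Or.inr ⟨b, a, d, hb, ha, ?_, ?_⟩
      · apply mem_nonZeroDivisors_of_ne_zero
        rintro rfl
        rw [map_zero] at hz
        rcases mul_eq_zero.1 hz with h | h
        · exact hz0 h
        · exact nonZeroDivisors.ne_zero hb0 ((map_eq_zero_iff _ (IsFractionRing.injective A (FractionRing A))).1 h)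
      · rw [← hz]; field_simp
  let S : IntermediateField ℂ L :=
    { ((K0 Hom h1 hmul hadd).map φ).comap ι with
      inv_mem' := by
        rintro x ⟨z, hz, hzx⟩
        refine ⟨z⁻¹, hinv z hz, ?_⟩
        change φ (z⁻¹) = ι (x⁻¹)
        rw [map_inv₀, map_inv₀]; congr 1 }
  have hS : S = ⊤ := by
    apply hgen
    intro a b d c e ha hb hc he he0
    have hb0 : b ≠ 0 := by
      rintro rfl
      rw [map_zero] at he
      have := he.symm
      simp [he0] at this
    have hb1 : algebraMap A (FractionRing A) b ≠ 0 := by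
      rwa [Ne, map_eq_zero_iff _ (IsFractionRing.injective A (FractionRing A))]
    have hz : (algebraMap A (FractionRing A) a / algebraMap A (FractionRing A) b) *
      algebraMap A (FractionRing A) b = algebraMap A (FractionRing A) a := by field_simp
    exact ⟨_, Or.inr ⟨a, b, d, ha, hb, mem_nonZeroDivisors_of_ne_zero hb0, hz⟩,
      (key _ a b d c e hb0 hz hc he).2⟩
  let φ' : ↥(K0 Hom h1 hmul hadd) →ₐ[ℂ] M := φ.comp (K0 Hom h1 hmul hadd).val
  have hφ' : Function.Injective φ' := φ.toRingHom.injective.comp Subtype.val_injective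
  have hιinj : Function.Injective ι := ι.toRingHom.injective
  have hr : φ'.range = ι.range := by
    apply le_antisymm
    · rintro _ ⟨z, rfl⟩
      obtain ⟨c, hc⟩ := hsub z
      exact ⟨c, hc⟩
    · rintro _ ⟨c, rfl⟩
      have : c ∈ S := by rw [hS]; trivial
      obtain ⟨z, hz, hzc⟩ := this
      exact ⟨⟨z, hz⟩, hzc⟩
  exact ⟨(AlgEquiv.ofInjective φ' hφ').trans ((Subalgebra.equivOfEq _ _ hr).trans
    (AlgEquiv.ofInjective ι hιinj).symm)⟩

theorem K0Quot_iso {n : ℕ} {w : Fin n → ℕ} {f : MvPolynomial (Fin n) ℂ} {e : ℕ}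
    (hf : f.IsWeightedHomogeneous w e) {L : Type*} [Field L] [Algebra ℂ L] (y : Fin n → L)
    (hfy : MvPolynomial.aeval y f = 0)
    (hdiv : ∀ (d : ℕ) (P : MvPolynomial (Fin n) ℂ), P.IsWeightedHomogeneous w d →
      MvPolynomial.aeval y P = 0 → f ∣ P)
    (i0 : Fin n) (hi0 : w i0 = 1) (hy0 : y i0 = 1)
    (hgen : ∀ S : IntermediateField ℂ L, (∀ i, y i ∈ S) → S = ⊤) :
    Nonempty (↥(K0Quot w f) ≃ₐ[ℂ] L) := by
  let ψ : (MvPolynomial (Fin n) ℂ ⧸ Ideal.span {f}) →ₐ[ℂ] Polynomial L :=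
    Ideal.Quotient.liftₐ _ (homSub w y) (by
      intro a ha
      obtain ⟨q, rfl⟩ := Ideal.mem_span_singleton.1 ha
      rw [map_mul, homSub_hom y hf, hfy]; simp)
  have hψ : ∀ p, ψ (Ideal.Quotient.mk _ p) = homSub w y p := fun p => rfl
  refine K0_iso _ _ _ _ ψ ?_ ?_ ?_
  · rw [injective_iff_map_eq_zero]
    intro a ha
    obtain ⟨p, rfl⟩ := Ideal.Quotient.mk_surjective a
    rw [hψ] at ha
    rw [Ideal.Quotient.eq_zero_iff_mem, Ideal.mem_span_singleton]
    apply dvd_of_comps w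
    intro d
    apply hdiv d _ (weightedHomogeneousComponent_isWeightedHomogeneous (w := w) _ p)
    rw [← homSub_coeff, ha, Polynomial.coeff_zero]
  · rintro _ d ⟨p, hp, rfl⟩
    exact ⟨_, homSub_hom y hp⟩
  · intro S hS
    apply hgen
    intro i
    have h1 := isWeightedHomogeneous_X ℂ w i
    have h2 := (isWeightedHomogeneous_X ℂ w i0).pow (w i)
    rw [hi0, smul_eq_mul, mul_one] at h2
    have := hS _ _ (w i) (y i) 1 ⟨_, h1, rfl⟩ ⟨_, h2, rfl⟩
      (by rw [hψ, homSub_hom y h1]; simp) (by rw [hψ, homSub_hom y h2]; simp [hy0]) one_ne_zero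
    simpa using this

theorem gen_frac {B : Type*} [CommRing B] [IsDomain B] [Algebra ℂ B]
    (S : IntermediateField ℂ (FractionRing B))
    (h : ∀ b : B, algebraMap B (FractionRing B) b ∈ S) : S = ⊤ := by
  rw [eq_top_iff]
  intro z _
  obtain ⟨a, b, _, rfl⟩ := IsFractionRing.div_surjective (A := B) z
  exact S.div_mem (h a) (h b)

section part1

/-- `Y_i ↦ x_{i+1} / x_0^{w}`. -/
def tauHom : MvPolynomial (Fin 4) ℂ →ₐ[ℂ] FractionRing (MvPolynomial (Fin 5) ℂ) :=
  MvPolynomial.aeval (fun i : Fin 4 =>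
    algebraMap (MvPolynomial (Fin 5) ℂ) (FractionRing (MvPolynomial (Fin 5) ℂ)) (X i.succ) /
    algebraMap (MvPolynomial (Fin 5) ℂ) (FractionRing (MvPolynomial (Fin 5) ℂ)) (X 0) ^ w5 i.succ)

theorem x0_ne : algebraMap (MvPolynomial (Fin 5) ℂ) (FractionRing (MvPolynomial (Fin 5) ℂ)) (X 0) ≠ 0 := by
  rw [Ne, map_eq_zero_iff _ (IsFractionRing.injective _ _)]
  exact X_ne_zero 0

theorem tau_num (q : MvPolynomial (Fin 4) ℂ) : ∃ (N : ℕ) (Q : MvPolynomial (Fin 5) ℂ),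
    tauHom q * algebraMap (MvPolynomial (Fin 5) ℂ) (FractionRing (MvPolynomial (Fin 5) ℂ)) (X 0) ^ N
      = algebraMap _ _ Q ∧
    MvPolynomial.aeval (Fin.cons 1 X : Fin 5 → MvPolynomial (Fin 4) ℂ) Q = q := by
  have h0 := x0_ne
  induction q using MvPolynomial.induction_on with
  | C a =>
    refine ⟨0, C a, ?_, by simp [algebraMap_eq]⟩
    simp only [tauHom, pow_zero, mul_one, aeval_C]
    rw [IsScalarTower.algebraMap_apply ℂ (MvPolynomial (Fin 5) ℂ)]
    rfl
  | add p q hp hq =>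
    obtain ⟨N1, Q1, h1, h1'⟩ := hp
    obtain ⟨N2, Q2, h2, h2'⟩ := hq
    refine ⟨N1 + N2, Q1 * X 0 ^ N2 + Q2 * X 0 ^ N1, ?_, by
      rw [map_add, map_mul, map_mul, map_pow, map_pow, aeval_X, h1', h2']; simp⟩
    simp only [map_add, map_mul, map_pow, ← h1, ← h2]
    ring
  | mul_X p i hp =>
    obtain ⟨N1, Q1, h1, h1'⟩ := hp
    refine ⟨N1 + w5 i.succ, Q1 * X i.succ, ?_, by rw [map_mul, h1', aeval_X]; simp⟩
    simp only [map_mul, ← h1]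
    have : tauHom (X i) = algebraMap (MvPolynomial (Fin 5) ℂ) (FractionRing (MvPolynomial (Fin 5) ℂ)) (X i.succ) /
      algebraMap (MvPolynomial (Fin 5) ℂ) (FractionRing (MvPolynomial (Fin 5) ℂ)) (X 0) ^ w5 i.succ := by
      simp [tauHom]
    rw [this]
    field_simp
    ring

theorem tau_inj : Function.Injective tauHom := by
  rw [injective_iff_map_eq_zero]
  intro q hq
  obtain ⟨N, Q, h1, h2⟩ := tau_num q
  rw [hq, zero_mul] at h1
  have h3 : Q = 0 := (map_eq_zero_iff _ (IsFractionRing.injective (MvPolynomial (Fin 5) ℂ)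
    (FractionRing (MvPolynomial (Fin 5) ℂ)))).1 h1.symm
  rw [← h2, h3, map_zero]

theorem part_one (h : MvPolynomial (Fin 4) ℂ) (hh : h.IsHomogeneous 4)
    (hsq : ¬ ∃ q : MvPolynomial (Fin 4) ℂ, h = q ^ 2)
    (g3 : MvPolynomial (Fin 5) ℂ) (hg3 : g3 ≠ 0)
    (hg3hom : g3.IsWeightedHomogeneous w5 3) (t : ℂ) (ht : t ≠ 0) :
    Nonempty (↥(K0Quot w6 (famPoly h g3 t)) ≃ₐ[ℂ] FractionRing (MvPolynomial (Fin 4) ℂ)) := by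
  let R := MvPolynomial (Fin 5) ℂ
  let M := FractionRing R
  let L := FractionRing (MvPolynomial (Fin 4) ℂ)
  let c : M := algebraMap R M (X 0)
  have hc : c ≠ 0 := x0_ne
  let ι : L →ₐ[ℂ] M := IsFractionRing.liftAlgHom (g := tauHom) tau_inj
  have hι : ∀ q : MvPolynomial (Fin 4) ℂ, ι (algebraMap _ L q) = tauHom q := fun q =>
    IsFractionRing.lift_algebraMap tau_inj q
  let yy : Fin 5 → L := Fin.cons 1 (fun i => algebraMap (MvPolynomial (Fin 4) ℂ) L (X i))
  have hyy : ∀ i, algebraMap R M (X i) = c ^ w5 i * ι (yy i) := by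
    intro i
    induction i using Fin.cases with
    | zero => simp [yy, w5, c]
    | succ i =>
      simp only [yy, Fin.cons_succ]
      rw [hι]
      simp only [tauHom, aeval_X]
      change _ = c ^ w5 i.succ * (_ / c ^ w5 i.succ)
      exact (mul_div_cancel₀ _ (pow_ne_zero _ hc)).symm
  have hRM : ∀ p : R, MvPolynomial.aeval (fun i => algebraMap R M (X i)) p = algebraMap R M p := by
    intro p
    have := (MvPolynomial.comp_aeval_apply (R := ℂ) (X : Fin 5 → R) (IsScalarTower.toAlgHom ℂ R M) p)
    rw [aeval_X_left] at this
    exact this.symm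
  have hhom : ∀ (p : R) (d : ℕ), p.IsWeightedHomogeneous w5 d →
      algebraMap R M p = c ^ d * ι (MvPolynomial.aeval yy p) := by
    intro p d hp
    rw [← hRM, aeval_wh hp c (fun i => ι (yy i)) _ hyy, MvPolynomial.comp_aeval_apply]
  have hgy : MvPolynomial.aeval yy g3 ≠ 0 := by
    intro h0
    have := hhom g3 3 hg3hom
    rw [h0, map_zero, mul_zero, map_eq_zero_iff _ (IsFractionRing.injective R M)] at this
    exact hg3 this
  let v : L := - MvPolynomial.aeval yy (f4 h) / MvPolynomial.aeval yy (C t * g3)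
  have htg : MvPolynomial.aeval yy (C t * g3) ≠ 0 := by
    rw [map_mul, aeval_C]
    exact mul_ne_zero (by simpa using ht) hgy
  have hv : v * MvPolynomial.aeval yy (C t * g3) = - MvPolynomial.aeval yy (f4 h) := by
    exact div_mul_cancel₀ _ htg
  let y : Fin 6 → L := Fin.snoc (α := fun _ => L) yy v
  have hy1 : ∀ i : Fin 5, y i.castSucc = yy i := fun i => by simp [y]
  have hy2 : y (Fin.last 5) = v := Fin.snoc_last (α := fun _ => L) v yy
  refine K0Quot_iso (fam_hom h hh g3 hg3hom t) y ?_ ?_ 0 rfl ?_ ?_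
  · rw [aeval_lastEquiv yy v y hy1 hy2, fam_last, Polynomial.eval₂_add, Polynomial.eval₂_mul,
      Polynomial.eval₂_C, Polynomial.eval₂_C, Polynomial.eval₂_X]
    change MvPolynomial.aeval yy (C t * g3) * v + MvPolynomial.aeval yy (f4 h) = 0
    rw [mul_comm, hv]; ring
  · intro d P hP hP0
    let z : Fin 6 → M := fun i => c ^ w6 i * ι (y i)
    have hz0 : MvPolynomial.aeval z P = 0 := by
      rw [aeval_wh hP c (fun i => ι (y i)) z (fun i => rfl), ← MvPolynomial.comp_aeval_apply, hP0,
        map_zero, mul_zero]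
    have hlast : w6 (Fin.last 5) = 1 := rfl
    rw [aeval_lastEquiv (fun i => algebraMap R M (X i)) (c * ι v) z (fun i => by
      simp only [z]; rw [hy1, hyy, w6_castSucc]) (by
      simp only [z]; rw [hy2, hlast, pow_one])] at hz0
    have hRM' : (MvPolynomial.aeval (R := ℂ) (fun i => algebraMap R M (X i))).toRingHom
        = algebraMap R M := RingHom.ext hRM
    rw [hRM'] at hz0
    rw [← map_dvd_iff (lastEquiv 5), fam_last]
    refine dvd_of_root (M := M) _ _ (mul_ne_zero (by simpa using ht) hg3)
      (fam_irred h hh hsq g3 hg3 hg3hom t ht) (c * ι v) ?_ _ hz0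
    rw [hhom _ 3 (hg3hom.C_mul t), hhom _ 4 (f4_hom h hh)]
    have := congrArg ι hv
    rw [map_mul, map_neg] at this
    linear_combination c ^ 4 * this
  · exact (hy1 0).trans (by simp [yy])
  · intro S hS
    apply gen_frac
    intro b
    have : algebraMap (MvPolynomial (Fin 4) ℂ) L b
        = MvPolynomial.aeval (fun i : Fin 4 => y i.succ.castSucc) b := by
      have h2 := (MvPolynomial.comp_aeval_apply (R := ℂ) (X : Fin 4 → MvPolynomial (Fin 4) ℂ)
        (IsScalarTower.toAlgHom ℂ (MvPolynomial (Fin 4) ℂ) L) b)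
      rw [aeval_X_left] at h2
      refine h2.trans ?_
      congr 2
      funext i
      rw [hy1]; simp [yy]
    rw [this]
    have h3 : MvPolynomial.aeval (fun i : Fin 4 => (⟨y i.succ.castSucc, hS _⟩ : S)) b ∈ (⊤ : Subalgebra ℂ S) := trivial
    have h4 := MvPolynomial.comp_aeval_apply (R := ℂ) (fun i : Fin 4 => (⟨y i.succ.castSucc, hS _⟩ : S)) S.val b
    have h5 : (fun i : Fin 4 => S.val (⟨y i.succ.castSucc, hS _⟩ : S)) = fun i : Fin 4 => y i.succ.castSucc := rfl
    rw [h5] at h4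
    rw [← h4]
    exact Subtype.property _

end part1

theorem mem_aeval {n : ℕ} {L : Type*} [Field L] [Algebra ℂ L] (S : IntermediateField ℂ L)
    (y : Fin n → L) (hS : ∀ i, y i ∈ S) (p : MvPolynomial (Fin n) ℂ) :
    MvPolynomial.aeval y p ∈ S := by
  have h4 := MvPolynomial.comp_aeval_apply (R := ℂ) (fun i => (⟨y i, hS i⟩ : S)) S.val p
  have h5 : (fun i => S.val (⟨y i, hS i⟩ : S)) = y := rfl
  rw [h5] at h4
  rw [← h4]
  exact Subtype.property _

theorem cone_iso {f : MvPolynomial (Fin 5) ℂ} {e : ℕ} (hf : f.IsWeightedHomogeneous w5 e)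
    {F : Type*} [Field F] [Algebra ℂ F] {K : Type*} [CommRing K] [IsDomain K] [Algebra ℂ K]
    (val : K →ₐ[ℂ] F) (ks : Fin 5 → K) (c : F) (hc : c ≠ 0)
    (hk0 : ks 0 = 1) (hfk : MvPolynomial.aeval ks f = 0)
    (hker : ∀ p : MvPolynomial (Fin 5) ℂ,
      MvPolynomial.aeval (fun i => c ^ w5 i * val (ks i)) p = 0 → f ∣ p)
    (hgen : ∀ k : K, ∃ p q : MvPolynomial (Fin 5) ℂ, MvPolynomial.aeval ks q ≠ 0 ∧
      k * MvPolynomial.aeval ks q = MvPolynomial.aeval ks p) :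
    Nonempty (↥(K0Quot w6 (rename Fin.castSucc f)) ≃ₐ[ℂ] FractionRing (Polynomial K)) := by
  let L := FractionRing (Polynomial K)
  let j : Polynomial K →ₐ[ℂ] L := IsScalarTower.toAlgHom ℂ (Polynomial K) L
  have hj : Function.Injective j := IsFractionRing.injective (Polynomial K) L
  let jc : K →ₐ[ℂ] L := j.comp (Polynomial.CAlgHom (R := ℂ) (A := K))
  have hjc : Function.Injective jc := hj.comp Polynomial.C_injective
  let y' : Fin 6 → Polynomial K := Fin.snoc (α := fun _ => Polynomial K)
    (fun i => Polynomial.C (ks i)) Polynomial.X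
  have hy1 : ∀ i : Fin 5, y' i.castSucc = Polynomial.C (ks i) := fun i => by simp [y']
  have hy2 : y' (Fin.last 5) = Polynomial.X :=
    Fin.snoc_last (α := fun _ => Polynomial K) _ _
  let y : Fin 6 → L := fun i => j (y' i)
  have hyP : ∀ P, MvPolynomial.aeval y P = j (MvPolynomial.aeval y' P) := fun P =>
    (MvPolynomial.comp_aeval_apply y' j P).symm
  have hyc : ∀ p : MvPolynomial (Fin 5) ℂ,
      MvPolynomial.aeval (fun i : Fin 5 => y i.castSucc) p = jc (MvPolynomial.aeval ks p) := by
    intro p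
    rw [MvPolynomial.comp_aeval_apply]
    congr 2
    funext i
    simp only [y]
    rw [hy1]; rfl
  refine K0Quot_iso (wh_rename w6_castSucc hf) y ?_ ?_ 0 rfl ?_ ?_
  · rw [MvPolynomial.aeval_rename]
    exact (hyc f).trans (by rw [hfk, map_zero])
  · intro d P hP hP0
    rw [hyP, map_eq_zero_iff _ hj] at hP0
    let θ : Polynomial K →ₐ[ℂ] Polynomial F :=
      { Polynomial.eval₂RingHom (Polynomial.C.comp val.toRingHom)
          (Polynomial.C c⁻¹ * Polynomial.X) with
        commutes' := fun r => by
          rw [Polynomial.algebraMap_apply, Polynomial.algebraMap_apply]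
          simp }
    have hθC : ∀ k, θ (Polynomial.C k) = Polynomial.C (val k) := fun k => by simp [θ]
    have hθX : θ Polynomial.X = Polynomial.C c⁻¹ * Polynomial.X := by simp [θ]
    have h1 : MvPolynomial.aeval (fun i => Polynomial.C c ^ w6 i * θ (y' i)) P = 0 := by
      rw [aeval_wh hP (Polynomial.C c) (fun i => θ (y' i)) _ (fun i => rfl),
        ← MvPolynomial.comp_aeval_apply, hP0, map_zero, mul_zero]
    have hlast : w6 (Fin.last 5) = 1 := rfl
    let xb : Fin 5 → F := fun i => c ^ w5 i * val (ks i)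
    rw [aeval_lastEquiv (fun i => Polynomial.C (xb i)) Polynomial.X _ (fun i => by
      rw [hy1, hθC, w6_castSucc]; simp [xb]) (by
      rw [hy2, hθX, hlast, pow_one, ← mul_assoc, ← Polynomial.C_mul, mul_inv_cancel₀ hc]; simp)] at h1
    have h2 : (MvPolynomial.aeval (R := ℂ) (fun i => Polynomial.C (xb i))).toRingHom
        = Polynomial.C.comp (MvPolynomial.aeval (R := ℂ) xb).toRingHom := by
      refine RingHom.ext fun p => ?_
      exact (MvPolynomial.comp_aeval_apply (R := ℂ) xb (Polynomial.CAlgHom (R := ℂ) (A := F)) p).symm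
    rw [h2, ← Polynomial.map] at h1
    rw [← map_dvd_iff (lastEquiv 5), lastEquiv_rename, Polynomial.C_dvd_iff_dvd_coeff]
    intro i
    apply hker
    have := congrArg (fun p => p.coeff i) h1
    simpa [Polynomial.coeff_map] using this
  · simp only [y]
    refine (congrArg j (hy1 0)).trans ?_
    rw [hk0]; simp
  · intro S hS
    apply gen_frac
    intro b
    change j b ∈ S
    induction b using Polynomial.induction_on' with
    | add p q hp hq => rw [map_add]; exact S.add_mem hp hq
    | monomial m k =>
      rw [← Polynomial.C_mul_X_pow_eq_monomial, map_mul, map_pow]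
      refine S.mul_mem ?_ (pow_mem ?_ m)
      · obtain ⟨p, q, hq, hk⟩ := hgen k
        have h3 : jc (MvPolynomial.aeval ks q) ≠ 0 := by rwa [Ne, map_eq_zero_iff _ hjc]
        have h4 : jc k = jc (MvPolynomial.aeval ks p) / jc (MvPolynomial.aeval ks q) := by
          rw [eq_div_iff h3, ← map_mul, hk]
        change jc k ∈ S
        rw [h4, ← hyc, ← hyc]
        exact S.div_mem (mem_aeval S _ (fun i => hS _) _) (mem_aeval S _ (fun i => hS _) _)
      · rw [← hy2]; exact hS _

theorem K0Quot_isDomain {n : ℕ} (w : Fin n → ℕ) (f : MvPolynomial (Fin n) ℂ)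
    [IsDomain (MvPolynomial (Fin n) ℂ ⧸ Ideal.span {f})] : IsDomain ↥(K0Quot w f) :=
  inferInstanceAs (IsDomain (K0Quot w f).toSubring)

theorem part_two (h : MvPolynomial (Fin 4) ℂ) (hh : h.IsHomogeneous 4)
    (hsq : ¬ ∃ q : MvPolynomial (Fin 4) ℂ, h = q ^ 2) :
    Nonempty (↥(K0Quot w6 (f4cone h)) ≃ₐ[ℂ] FractionRing (Polynomial ↥(K0Quot w5 (f4 h)))) := by
  have hp : Prime (f4 h) := (f4_irred h hsq).prime
  have hI : (Ideal.span {f4 h}).IsPrime := (Ideal.span_singleton_prime hp.ne_zero).2 hp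
  let A := MvPolynomial (Fin 5) ℂ ⧸ Ideal.span {f4 h}
  have hA : IsDomain A := Ideal.Quotient.isDomain _
  let F := FractionRing A
  have hK : IsDomain ↥(K0Quot w5 (f4 h)) := K0Quot_isDomain _ _
  let mkF : MvPolynomial (Fin 5) ℂ →ₐ[ℂ] F :=
    (IsScalarTower.toAlgHom ℂ A F).comp (Ideal.Quotient.mkₐ ℂ _)
  have hmk : ∀ p, mkF p = algebraMap A F (Ideal.Quotient.mk _ p) := fun p => rfl
  have hmk0 : ∀ p, mkF p = 0 ↔ f4 h ∣ p := by
    intro p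
    rw [hmk, map_eq_zero_iff _ (IsFractionRing.injective A F), Ideal.Quotient.eq_zero_iff_mem,
      Ideal.mem_span_singleton]
  let c : F := mkF (X 0)
  have hc : c ≠ 0 := by
    rw [Ne, hmk0]
    exact not_dvd_of_lt (f4_hom h hh) (isWeightedHomogeneous_X ℂ w5 0) (by simp [w5]) (X_ne_zero 0)
  have hmem : ∀ i, mkF (X i) / c ^ w5 i ∈ K0Quot w5 (f4 h) := by
    intro i
    have h2 := (isWeightedHomogeneous_X ℂ w5 0).pow (w5 i)
    have h3 : w5 i • w5 0 = w5 i := by simp [w5]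
    rw [h3] at h2
    refine Or.inr ⟨Ideal.Quotient.mk _ (X i), Ideal.Quotient.mk _ (X 0 ^ w5 i), w5 i,
      ⟨_, isWeightedHomogeneous_X ℂ w5 i, rfl⟩, ⟨_, h2, rfl⟩, ?_, ?_⟩
    · apply mem_nonZeroDivisors_of_ne_zero
      intro h0
      have : mkF (X 0 ^ w5 i) = 0 := by rw [hmk, h0, map_zero]
      rw [map_pow] at this
      exact pow_ne_zero _ hc this
    · change _ / _ * mkF (X 0 ^ w5 i) = mkF (X i)
      rw [map_pow]
      exact div_mul_cancel₀ _ (pow_ne_zero _ hc)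
  let ks : Fin 5 → ↥(K0Quot w5 (f4 h)) := fun i => ⟨_, hmem i⟩
  let val : ↥(K0Quot w5 (f4 h)) →ₐ[ℂ] F := (K0Quot w5 (f4 h)).val
  have hval : Function.Injective val := Subtype.val_injective
  have hxk : ∀ i, mkF (X i) = c ^ w5 i * val (ks i) := fun i =>
    (mul_div_cancel₀ _ (pow_ne_zero _ hc)).symm
  have hmkF : ∀ p, MvPolynomial.aeval (fun i => mkF (X i)) p = mkF p := fun p => by
    rw [← MvPolynomial.comp_aeval_apply, aeval_X_left]; rfl
  have hhom : ∀ (p) (d : ℕ), p.IsWeightedHomogeneous w5 d →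
      mkF p = c ^ d * val (MvPolynomial.aeval ks p) := by
    intro p d hp
    rw [← hmkF, aeval_wh hp c (fun i => val (ks i)) _ hxk, MvPolynomial.comp_aeval_apply]
  refine cone_iso (f4_hom h hh) val ks c hc ?_ ?_ ?_ ?_
  · apply hval
    rw [map_one]
    change c / c ^ 1 = 1
    rw [pow_one, div_self hc]
  · apply hval
    have h1 := hhom _ 4 (f4_hom h hh)
    rw [(hmk0 _).2 dvd_rfl] at h1
    rw [map_zero]
    exact (mul_eq_zero.1 h1.symm).resolve_left (pow_ne_zero _ hc)
  · intro p hp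
    rw [← hmk0, ← hmkF, ← hp]
    congr 2
    funext i
    exact hxk i
  · rintro ⟨k, hk⟩
    rcases hk with rfl | ⟨_, _, d, ⟨p, hp, rfl⟩, ⟨q, hq, rfl⟩, hb0, hz⟩
    · exact ⟨0, 1, by simp, by rw [map_zero, map_one, mul_one]; rfl⟩
    · refine ⟨p, q, ?_, ?_⟩
      · intro h0
        have h1 := hhom q d hq
        rw [h0, map_zero, mul_zero, hmk, map_eq_zero_iff _ (IsFractionRing.injective A F)] at h1
        exact nonZeroDivisors.ne_zero hb0 h1
      · apply hval
        rw [map_mul]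
        change k * mkF q = mkF p at hz
        rw [hhom q d hq, hhom p d hp] at hz
        apply mul_left_cancel₀ (pow_ne_zero d hc)
        rw [← hz]
        change _ * (k * _) = _
        ring

theorem frac_mv_aux (n : ℕ) (K L T : Type*) [CommRing K] [IsDomain K] [Algebra ℂ K]
    [Field L] [Algebra (Polynomial K) L] [IsFractionRing (Polynomial K) L] [Algebra ℂ L]
    [IsScalarTower ℂ (Polynomial K) L]
    [Field T] [Algebra (MvPolynomial (Fin n) L) T] [IsFractionRing (MvPolynomial (Fin n) L) T]
    [Algebra ℂ T] [IsScalarTower ℂ (MvPolynomial (Fin n) L) T] :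
    Nonempty (FractionRing (MvPolynomial (Fin (n + 1)) K) ≃ₐ[ℂ] T) := by
  let B := MvPolynomial (Fin n) (Polynomial K)
  let _ : Algebra B (MvPolynomial (Fin n) L) := algebraMvPolynomial
  let _ : Algebra B T := ((algebraMap (MvPolynomial (Fin n) L) T).comp
    (algebraMap B (MvPolynomial (Fin n) L))).toAlgebra
  have : IsScalarTower B (MvPolynomial (Fin n) L) T := IsScalarTower.of_algebraMap_eq fun _ => rfl
  have hfr : IsFractionRing B T := by
    let M : Submonoid B := (nonZeroDivisors (Polynomial K)).map (C (σ := Fin n))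
    have hloc : IsLocalization M (MvPolynomial (Fin n) L) := MvPolynomial.isLocalization _ _
    have hM : M ≤ nonZeroDivisors B := by
      rintro _ ⟨a, ha, rfl⟩
      apply mem_nonZeroDivisors_of_ne_zero
      exact (map_ne_zero_iff _ (C_injective (Fin n) (Polynomial K))).2 (nonZeroDivisors.ne_zero ha)
    have hinj : Function.Injective (algebraMap B T) :=
      (IsFractionRing.injective (MvPolynomial (Fin n) L) T).comp
        (IsLocalization.injective (MvPolynomial (Fin n) L) hM)
    have : FaithfulSMul B T := (faithfulSMul_iff_algebraMap_injective B T).2 hinj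
    have hS0 : ∀ s : M, algebraMap B T s ≠ 0 := fun s hs =>
      nonZeroDivisors.ne_zero (hM s.2) (hinj (by rw [hs, map_zero]))
    have hfrac : ∀ p : MvPolynomial (Fin n) L, ∃ (x : B) (s : M),
        algebraMap (MvPolynomial (Fin n) L) T p = algebraMap B T x / algebraMap B T s := by
      intro p
      obtain ⟨⟨x, s⟩, hx⟩ := IsLocalization.surj M p
      refine ⟨x, s, ?_⟩
      rw [eq_div_iff (hS0 s)]
      rw [IsScalarTower.algebraMap_apply B (MvPolynomial (Fin n) L) T,
        IsScalarTower.algebraMap_apply B (MvPolynomial (Fin n) L) T, ← map_mul, hx]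
    refine IsFractionRing.of_field B T fun z => ?_
    obtain ⟨p, q, -, rfl⟩ := IsFractionRing.div_surjective (A := MvPolynomial (Fin n) L) z
    obtain ⟨x, s, hx⟩ := hfrac p
    obtain ⟨y, r, hy⟩ := hfrac q
    refine ⟨x * r, s * y, ?_⟩
    rw [hx, hy, map_mul, map_mul, div_div_div_eq]
  have : IsScalarTower ℂ B T := by
    refine IsScalarTower.of_algebraMap_eq fun r => ?_
    rw [IsScalarTower.algebraMap_apply ℂ (MvPolynomial (Fin n) L) T]
    change _ = algebraMap (MvPolynomial (Fin n) L) T (algebraMap B (MvPolynomial (Fin n) L) _)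
    congr 1
    rw [MvPolynomial.algebraMap_def, MvPolynomial.algebraMap_apply, MvPolynomial.algebraMap_apply, map_C]
    congr 1
    exact IsScalarTower.algebraMap_apply ℂ (Polynomial K) L r
  have e2 : MvPolynomial (Fin (n + 1)) K ≃ₐ[ℂ] B :=
    ((renameEquiv K (_root_.finSuccEquivLast (n := n))).trans
      (optionEquivRight K (Fin n))).restrictScalars ℂ
  exact ⟨IsFractionRing.algEquivOfAlgEquiv e2⟩

theorem frac_mv_iso (n : ℕ) (K K' : Type*) [CommRing K] [IsDomain K] [Algebra ℂ K]
    [CommRing K'] [Algebra ℂ K'] (e : K' ≃ₐ[ℂ] FractionRing (Polynomial K)) :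
    Nonempty (FractionRing (MvPolynomial (Fin n) K') ≃ₐ[ℂ]
      FractionRing (MvPolynomial (Fin (n + 1)) K)) := by
  have e1 : FractionRing (MvPolynomial (Fin n) K') ≃ₐ[ℂ]
      FractionRing (MvPolynomial (Fin n) (FractionRing (Polynomial K))) :=
    IsFractionRing.algEquivOfAlgEquiv (MvPolynomial.mapAlgEquiv (Fin n) e)
  obtain ⟨e3⟩ := frac_mv_aux n K (FractionRing (Polynomial K))
    (FractionRing (MvPolynomial (Fin n) (FractionRing (Polynomial K))))
  exact ⟨e1.trans e3.symm⟩

/-- function-field content of the main theorem: rationality does not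
specialize in the family `{f₄ + t·g₃·x₅ = 0} ⊂ P(1,1,1,1,2,1)`.
Let `h ∈ ℂ[x₀,…,x₃]` be homogeneous of degree `4` and not a square, set `f₄ = x₄² − h`,
let `A = ℂ[x₀,…,x₄]/(f₄)` with weights `(1,1,1,1,2)`, and let `g₃ ∈ ℂ[x₀,…,x₄]` be
nonzero and weighted-homogeneous of degree `3`.  Then:
(i) for every `t ≠ 0` the function field `K₀(ℂ[x₀,…,x₅]/(f₄ + t·g₃·x₅))` of `X_t` is
`ℂ`-isomorphic to the rational function field `ℂ(y₁,y₂,y₃,y₄)`, so `X_t` is rational; and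
(ii) the function field `K₀(A[x₅])` of `X₀` is isomorphic (as a field) to the rational
function field `K₀(A)(u)` in one variable over the function field of `Y`, and
consequently if `K₀(A)` is stably irrational then so is `K₀(A[x₅])`: `X₀` is stably
irrational whenever `Y` is. -/
theorem statement10 (h : MvPolynomial (Fin 4) ℂ) (hh : h.IsHomogeneous 4)
    (hsq : ¬ ∃ q : MvPolynomial (Fin 4) ℂ, h = q ^ 2)
    (g3 : MvPolynomial (Fin 5) ℂ) (hg3 : g3 ≠ 0)
    (hg3hom : g3.IsWeightedHomogeneous w5 3) :
    (∀ t : ℂ, t ≠ 0 →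
      Nonempty (↥(K0Quot w6 (famPoly h g3 t)) ≃ₐ[ℂ]
        FractionRing (MvPolynomial (Fin 4) ℂ))) ∧
    Nonempty (↥(K0Quot w6 (f4cone h)) ≃+*
      FractionRing (Polynomial ↥(K0Quot w5 (f4 h)))) ∧
    (StablyIrrational ↥(K0Quot w5 (f4 h)) →
      StablyIrrational ↥(K0Quot w6 (f4cone h))) := by
  refine ⟨fun t ht => part_one h hh hsq g3 hg3 hg3hom t ht, ?_, ?_⟩
  · obtain ⟨e⟩ := part_two h hh hsq
    exact ⟨e.toRingEquiv⟩
  · intro hst n m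
    refine ⟨fun E => ?_⟩
    obtain ⟨e⟩ := part_two h hh hsq
    have hp := (f4_irred h hsq).prime
    have : (Ideal.span {f4 h}).IsPrime := (Ideal.span_singleton_prime hp.ne_zero).2 hp
    have : IsDomain (MvPolynomial (Fin 5) ℂ ⧸ Ideal.span {f4 h}) := Ideal.Quotient.isDomain _
    have : IsDomain ↥(K0Quot w5 (f4 h)) := inferInstance
    obtain ⟨e'⟩ := frac_mv_iso n _ _ e
    exact (hst (n+1) m).false (e'.symm.trans E)
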